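/- arXiv:2602.01421 — 4 statements merged into one kernel-verified Lean document; each statement's English description precedes it below -/
import Mathlib

section
/- Let α > 1, let b ∈ (0, 1/2), let H = ℝ² with the Euclidean inner product, let e₁ = (1,0), e₂ = (0,1), D = {e₁, −e₁, e₂, −e₂}, and f = (1−b)·e₁ + b·e₂. Let (T_m)_{m≥1} be any sequence in ℝ² with T₁ = (1−b)·e₁ and, for each m ≥ 2, T_m = (1 − 1/m^α)·T_{m−1} + (1/m^α)·g_m for some g_m ∈ D. Then for every m ≥ 1, ‖f − T_m‖₂ ≥ b·P_α/√2 > 0, where P_α = ∏_{k=2}^∞ (1 − 1/k^α). In particular, inf_m ‖f − T_m‖₂ > 0, so the Power–Relaxed Greedy Algorithm with exponent α > 1 does not converge for this f. -/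
/-- Shifted `p`-series: `∑ 1 / (k + 2) ^ α` converges for `α > 1`. -/
theorem summable_one_div_add_two_rpow {α : ℝ} (hα : 1 < α) :
    Summable fun k : ℕ => 1 / ((k : ℝ) + 2) ^ α := by
  have h := (summable_nat_add_iff 2).mpr (Real.summable_one_div_nat_rpow.mpr hα)
  simpa using h

theorem one_div_add_two_rpow_lt_one {α : ℝ} (hα : 1 < α) (k : ℕ) :
    1 / ((k : ℝ) + 2) ^ α < 1 := by
  have h : 1 < ((k : ℝ) + 2) ^ α :=
    Real.one_lt_rpow (by linarith [(k.cast_nonneg : (0 : ℝ) ≤ k)]) (by linarith)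
  exact (div_lt_one (by linarith)).mpr h

theorem summable_log_one_sub_one_div_add_two_rpow {α : ℝ} (hα : 1 < α) :
    Summable fun k : ℕ => Real.log (1 - 1 / ((k : ℝ) + 2) ^ α) := by
  simpa [sub_eq_add_neg] using
    Real.summable_log_one_add_of_summable (summable_one_div_add_two_rpow hα).neg

theorem tprod_one_sub_one_div_add_two_rpow_pos {α : ℝ} (hα : 1 < α) :
    0 < ∏' k : ℕ, (1 - 1 / ((k : ℝ) + 2) ^ α) := by
  rw [← Real.rexp_tsum_eq_tprod (fun k => sub_pos.mpr (one_div_add_two_rpow_lt_one hα k))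
    (summable_log_one_sub_one_div_add_two_rpow hα)]
  exact Real.exp_pos _

theorem tprod_le_prod_range_one_sub_one_div_add_two_rpow {α : ℝ} (hα : 1 < α) (n : ℕ) :
    ∏' k : ℕ, (1 - 1 / ((k : ℝ) + 2) ^ α) ≤
      ∏ k ∈ Finset.range n, (1 - 1 / ((k : ℝ) + 2) ^ α) := by
  have hpos : ∀ k : ℕ, 0 < 1 - 1 / ((k : ℝ) + 2) ^ α := fun k =>
    sub_pos.mpr (one_div_add_two_rpow_lt_one hα k)
  have hm : Multipliable fun k : ℕ => 1 - 1 / ((k : ℝ) + 2) ^ α :=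
    Real.multipliable_of_summable_log hpos (summable_log_one_sub_one_div_add_two_rpow hα)
  refine Antitone.le_of_tendsto (antitone_nat_of_succ_le fun n => ?_) hm.hasProd.tendsto_prod_nat n
  rw [Finset.prod_range_succ]
  refine mul_le_of_le_one_right (Finset.prod_nonneg fun k _ => (hpos k).le) ?_
  have : 0 ≤ 1 / ((n : ℝ) + 2) ^ α := by positivity
  linarith

/-- The coordinate sum is bounded by `√2` times the Euclidean norm. -/
theorem EuclideanSpace.add_div_sqrt_two_le_norm (v : EuclideanSpace ℝ (Fin 2)) :
    (v 0 + v 1) / Real.sqrt 2 ≤ ‖v‖ := by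
  rw [EuclideanSpace.norm_eq, div_le_iff₀ (by positivity), ← Real.sqrt_mul (by positivity)]
  refine Real.le_sqrt_of_sq_le ?_
  simp only [Fin.sum_univ_two, Real.norm_eq_abs, sq_abs]
  nlinarith [sq_nonneg (v 0 - v 1)]


open RealInnerProductSpace

/-- Non-convergence of the Power-Relaxed Greedy Algorithm for `α > 1`:
in `ℝ²` with the Euclidean inner product, dictionary `{±e₁, ±e₂}` and
`f = (1-b)e₁ + be₂` with `0 < b < 1/2`, any PRGA-type iterate sequence
(with `T₁ = (1-b)e₁` and arbitrary atoms `g_m ∈ D` for `m ≥ 2`) satisfies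
`‖f - T_m‖ ≥ b P_α / √2 > 0` for all `m ≥ 1`, where
`P_α = ∏_{k=2}^∞ (1 - 1/k^α)`. -/
theorem stmt_1 (α : ℝ) (hα : 1 < α) (b : ℝ) (hb : b ∈ Set.Ioo (0 : ℝ) (1 / 2))
    (e1 e2 : EuclideanSpace ℝ (Fin 2))
    (he1 : e1 = EuclideanSpace.single 0 1) (he2 : e2 = EuclideanSpace.single 1 1)
    (D : Set (EuclideanSpace ℝ (Fin 2))) (hD : D = {e1, -e1, e2, -e2})
    (f : EuclideanSpace ℝ (Fin 2)) (hf : f = (1 - b) • e1 + b • e2)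
    (T : ℕ → EuclideanSpace ℝ (Fin 2))
    (hT1 : T 1 = (1 - b) • e1)
    (hTm : ∀ m : ℕ, 2 ≤ m → ∃ g ∈ D,
      T m = (1 - 1 / (m : ℝ) ^ α) • T (m - 1) + (1 / (m : ℝ) ^ α) • g) :
    (∀ m : ℕ, 1 ≤ m →
      b * (∏' k : ℕ, (1 - 1 / ((k : ℝ) + 2) ^ α)) / Real.sqrt 2 ≤ ‖f - T m‖) ∧
    0 < b * (∏' k : ℕ, (1 - 1 / ((k : ℝ) + 2) ^ α)) / Real.sqrt 2 := by
  have hb0 : 0 < b := hb.1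
  refine ⟨?_, by have := tprod_one_sub_one_div_add_two_rpow_pos hα; positivity⟩
  have hatom : ∀ g ∈ D, g 0 + g 1 ≤ 1 := by
    subst hD he1 he2
    rintro g (rfl | rfl | rfl | rfl) <;> simp
  have key : ∀ n : ℕ, b * ∏ k ∈ Finset.range n, (1 - 1 / ((k : ℝ) + 2) ^ α) ≤
      1 - (T (n + 1) 0 + T (n + 1) 1) := by
    intro n
    induction n with
    | zero => simp [hT1, he1]
    | succ n ih =>
      obtain ⟨g, hg, hT⟩ := hTm (n + 2) (by omega)
      have hcast : ((n + 2 : ℕ) : ℝ) = (n : ℝ) + 2 := by push_cast; ring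
      rw [hcast, show n + 2 - 1 = n + 1 by omega] at hT
      rw [Finset.prod_range_succ, show n + 1 + 1 = n + 2 by omega, hT]
      simp only [PiLp.add_apply, PiLp.smul_apply, smul_eq_mul]
      have h0 : 0 ≤ 1 / ((n : ℝ) + 2) ^ α := by positivity
      have h1 := sub_pos.mpr (one_div_add_two_rpow_lt_one hα n)
      generalize 1 / ((n : ℝ) + 2) ^ α = t at h0 h1 ⊢
      linarith [mul_le_mul_of_nonneg_left ih h1.le, mul_le_mul_of_nonneg_left (hatom g hg) h0]
  intro m hm
  obtain ⟨n, rfl⟩ := Nat.exists_eq_add_of_le' hm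
  refine le_trans ?_ (EuclideanSpace.add_div_sqrt_two_le_norm _)
  have hfsum : f 0 + f 1 = 1 := by simp [hf, he1, he2]
  have hle := mul_le_mul_of_nonneg_left
    (tprod_le_prod_range_one_sub_one_div_add_two_rpow hα n) hb0.le
  gcongr
  simp only [PiLp.sub_apply]
  linarith [key n]
end

section
/- Let α > 1, b ∈ (0,1/2), and let (T_m)_{m≥1} be a sequence in ℝ² with T₁ = (1−b, 0) and T_m = (1 − 1/m^α) T_{m−1} + (1/m^α) g_m for m ≥ 2, where each g_m ∈ {(1,0), (−1,0), (0,1), (0,−1)}. Then for every m ≥ 1, ‖T_m‖₁ ≤ 1 − b·P_α, where ‖·‖₁ is the ℓ¹-norm on ℝ² and P_α = ∏_{k=2}^∞ (1 − 1/k^α). -/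
open Finset in
/-- An infinite product of factors in `[0, 1]` is at most each of its partial products. -/
lemma tprod_le_prod_range_of_le_one {f : ℕ → ℝ} (hf : Multipliable f)
    (h0 : ∀ k, 0 ≤ f k) (h1 : ∀ k, f k ≤ 1) (n : ℕ) : ∏' k, f k ≤ ∏ k ∈ range n, f k := by
  refine Antitone.le_of_tendsto (antitone_nat_of_succ_le fun k ↦ ?_) hf.hasProd.tendsto_prod_nat n
  rw [prod_range_succ]
  exact mul_le_of_le_one_right (prod_nonneg fun i _ ↦ h0 i) (h1 k)

lemma one_div_add_two_rpow_mem_Icc {α : ℝ} (hα : 0 ≤ α) (k : ℕ) :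
    1 / ((k : ℝ) + 2) ^ α ∈ Set.Icc (0 : ℝ) 1 := by
  have h : (1 : ℝ) ≤ ((k : ℝ) + 2) ^ α :=
    Real.one_le_rpow (by linarith [Nat.cast_nonneg (α := ℝ) k]) hα
  exact ⟨by positivity, div_le_one_of_le₀ h (by linarith)⟩

lemma multipliable_one_sub_one_div_add_two_rpow {α : ℝ} (hα : 1 < α) :
    Multipliable fun k : ℕ ↦ 1 - 1 / ((k : ℝ) + 2) ^ α := by
  have h : Summable fun k : ℕ ↦ -(1 / ((k : ℝ) + 2) ^ α) := by
    simpa using ((summable_nat_add_iff 2).2 (Real.summable_one_div_nat_rpow.2 hα)).neg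
  simpa [sub_eq_add_neg] using Real.multipliable_one_add_of_summable h

/-- A relaxed step with a dictionary element stays `ℓ¹`-bounded by the convex combination. -/
lemma abs_add_abs_relaxed_le {t : ℝ} (ht : t ∈ Set.Icc (0 : ℝ) 1) (x : ℝ × ℝ) {g : ℝ × ℝ}
    (hg : g ∈ ({(1, 0), (-1, 0), (0, 1), (0, -1)} : Set (ℝ × ℝ))) :
    |((1 - t) • x + t • g).1| + |((1 - t) • x + t • g).2| ≤ (1 - t) * (|x.1| + |x.2|) + t := by
  have hg1 : |g.1| + |g.2| = 1 := by
    rcases hg with rfl | rfl | rfl | rfl <;> simp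
  have h1 := abs_add_le ((1 - t) * x.1) (t * g.1)
  have h2 := abs_add_le ((1 - t) * x.2) (t * g.2)
  rw [abs_mul, abs_mul, abs_of_nonneg ht.1, abs_of_nonneg (sub_nonneg.2 ht.2)] at h1 h2
  simp only [Prod.fst_add, Prod.snd_add, Prod.smul_fst, Prod.smul_snd, smul_eq_mul]
  linear_combination h1 + h2 + t * hg1

/-- The ℓ¹-norm of the PRGA iterates in `ℝ²` with dictionary `{±e₁, ±e₂}`,
starting from `T₁ = (1-b)e₁`, stays bounded by `1 - b P_α` when `α > 1`,
where `P_α = ∏_{k=2}^∞ (1 - 1/k^α)` (realized as a `tprod` via `k ↦ k + 2`).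
Here `ℝ²` is modeled as `ℝ × ℝ` and the ℓ¹-norm of `x` is `|x.1| + |x.2|`. -/
theorem stmt_3 (α : ℝ) (hα : 1 < α) (b : ℝ) (hb : b ∈ Set.Ioo (0 : ℝ) (1 / 2))
    (T : ℕ → ℝ × ℝ) (hT1 : T 1 = (1 - b, 0))
    (hTm : ∀ m : ℕ, 2 ≤ m →
      ∃ g ∈ ({(1, 0), (-1, 0), (0, 1), (0, -1)} : Set (ℝ × ℝ)),
        T m = (1 - 1 / (m : ℝ) ^ α) • T (m - 1) + (1 / (m : ℝ) ^ α) • g) :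
    ∀ m : ℕ, 1 ≤ m →
      |(T m).1| + |(T m).2| ≤ 1 - b * ∏' k : ℕ, (1 - 1 / ((k : ℝ) + 2) ^ α) := by
  have ht := one_div_add_two_rpow_mem_Icc (α := α) (by linarith)
  have key : ∀ n : ℕ, |(T (n + 1)).1| + |(T (n + 1)).2| ≤
      1 - b * ∏ k ∈ Finset.range n, (1 - 1 / ((k : ℝ) + 2) ^ α) := by
    intro n
    induction n with
    | zero => simp [hT1, abs_of_nonneg (show 0 ≤ 1 - b by linarith [hb.2])]
    | succ n ih =>
      obtain ⟨g, hg, hT⟩ := hTm (n + 1 + 1) (by omega)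
      have hcast : ((n + 1 + 1 : ℕ) : ℝ) = (n : ℝ) + 2 := by push_cast; ring
      rw [hcast, Nat.add_sub_cancel] at hT
      rw [hT, Finset.prod_range_succ]
      refine (abs_add_abs_relaxed_le (ht n) _ hg).trans ?_
      linear_combination (mul_le_mul_of_nonneg_left ih (sub_nonneg.2 (ht n).2))
  intro m hm
  obtain ⟨n, rfl⟩ := Nat.exists_eq_add_of_le' hm
  have hle := tprod_le_prod_range_of_le_one (multipliable_one_sub_one_div_add_two_rpow hα)
    (fun k ↦ sub_nonneg.2 (ht k).2) (fun k ↦ sub_le_self 1 (ht k).1) n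
  linarith [key n, mul_le_mul_of_nonneg_left hle hb.1.le]
end

section
/- Let H be a real Hilbert space, D ⊆ H a symmetric set of unit vectors, and f in the closed convex hull of D. Let (f_m)_{m≥0} be the Convex-Relaxed Greedy Algorithm iterates: f₀ = 0, and for m ≥ 1, f_m = (1 − γ_m) f_{m−1} + γ_m g_m where g_m ∈ D satisfies ⟨f − f_{m−1}, g_m⟩ = sup_{g ∈ D} ⟨f − f_{m−1}, g⟩, f_{m-1} lies in the convex hull of D ∪ {0}, and γ_m ∈ [0,1] minimizes γ ↦ ‖f − ((1−γ) f_{m−1} + γ g_m)‖² over [0,1]. Then with a_m := ‖f − f_m‖², one has the one-step decay a_m ≤ a_{m−1} − a_{m−1}²/4 for every m ≥ 1. -/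
open RealInnerProductSpace

/-- A linear functional bounded above by `c` on a set is bounded by `c` on its closed convex hull. -/
theorem inner_le_of_mem_closure_convexHull {H : Type*} [NormedAddCommGroup H]
    [InnerProductSpace ℝ H] {D : Set H} {r f : H} {c : ℝ} (hD : ∀ x ∈ D, ⟪r, x⟫ ≤ c)
    (hf : f ∈ closure (convexHull ℝ D)) : ⟪r, f⟫ ≤ c := by
  have hconv : Convex ℝ {x : H | ⟪r, x⟫ ≤ c} :=
    convex_halfSpace_le (innerSL ℝ r).toLinearMap.isLinear c
  have hclosed : IsClosed {x : H | ⟪r, x⟫ ≤ c} :=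
    isClosed_le (by fun_prop) continuous_const
  exact closure_minimal (convexHull_min hD hconv) hclosed hf

/-- The closed convex hull of a subset of the unit ball lies in the unit ball. -/
theorem norm_le_one_of_mem_closure_convexHull {H : Type*} [NormedAddCommGroup H]
    [NormedSpace ℝ H] {D : Set H} {f : H} (hD : ∀ x ∈ D, ‖x‖ ≤ 1)
    (hf : f ∈ closure (convexHull ℝ D)) : ‖f‖ ≤ 1 := by
  have h : closure (convexHull ℝ D) ⊆ Metric.closedBall 0 1 :=
    closure_minimal (convexHull_min (fun x hx => by simpa using hD x hx)
      (convex_closedBall 0 1)) Metric.isClosed_closedBall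
  simpa using h hf

/-- One-step decay of the CRGA: with `D` a symmetric set of unit vectors in a
real Hilbert space, `f` in the closed convex hull of `D`, and `(F m)` the
Convex-Relaxed Greedy Algorithm iterates (greedy atom selection, iterates lying
in the convex hull of `D ∪ {0}`, exact line search over `γ ∈ [0,1]`), the
errors `a_m = ‖f - F m‖²` satisfy `a_m ≤ a_{m-1} - a_{m-1}²/4` for `m ≥ 1`. -/
theorem stmt_8 {H : Type*} [NormedAddCommGroup H] [InnerProductSpace ℝ H]
    [CompleteSpace H]
    (D : Set H) (hDunit : ∀ g ∈ D, ‖g‖ = 1) (hDsym : ∀ g ∈ D, -g ∈ D)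
    (f : H) (hf : f ∈ closure (convexHull ℝ D))
    (F g : ℕ → H) (γ : ℕ → ℝ)
    (hF0 : F 0 = 0)
    (hFconv : ∀ m : ℕ, 1 ≤ m → F (m - 1) ∈ convexHull ℝ (D ∪ {0}))
    (hg : ∀ m : ℕ, 1 ≤ m → g m ∈ D ∧
      ⟪f - F (m - 1), g m⟫ = sSup ((fun x => ⟪f - F (m - 1), x⟫) '' D))
    (hγ : ∀ m : ℕ, 1 ≤ m → γ m ∈ Set.Icc (0 : ℝ) 1 ∧
      ∀ t ∈ Set.Icc (0 : ℝ) 1,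
        ‖f - ((1 - γ m) • F (m - 1) + γ m • g m)‖ ^ 2 ≤
          ‖f - ((1 - t) • F (m - 1) + t • g m)‖ ^ 2)
    (hFm : ∀ m : ℕ, 1 ≤ m → F m = (1 - γ m) • F (m - 1) + γ m • g m) :
    ∀ m : ℕ, 1 ≤ m →
      ‖f - F m‖ ^ 2 ≤ ‖f - F (m - 1)‖ ^ 2 - (‖f - F (m - 1)‖ ^ 2) ^ 2 / 4 := by
  intro m hm
  obtain ⟨hgD, hgsup⟩ := hg m hm
  have hh : ‖F (m - 1)‖ ≤ 1 :=
    norm_le_one_of_mem_closure_convexHull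
      (by rintro x (hx | rfl)
          · exact (hDunit x hx).le
          · simp)
      (subset_closure (hFconv m hm))
  have hf1 : ‖f‖ ≤ 1 :=
    norm_le_one_of_mem_closure_convexHull (fun x hx => (hDunit x hx).le) hf
  have hmin := (hγ m hm).2
  rw [← hFm m hm] at hmin
  generalize F (m - 1) = h at *
  have hbdd : BddAbove ((fun x => ⟪f - h, x⟫) '' D) := by
    refine ⟨‖f - h‖, ?_⟩
    rintro _ ⟨x, hx, rfl⟩
    simpa [hDunit x hx] using real_inner_le_norm (f - h) x
  have hinner : ⟪f - h, f⟫ ≤ ⟪f - h, g m⟫ :=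
    inner_le_of_mem_closure_convexHull
      (fun x hx => hgsup ▸ le_csSup hbdd (Set.mem_image_of_mem _ hx)) hf
  have hdecr : ‖f - h‖ ^ 2 ≤ ⟪f - h, g m - h⟫ := by
    rw [← real_inner_self_eq_norm_sq, inner_sub_right (f - h) f h, inner_sub_right]
    linarith
  have hr : ‖f - h‖ ≤ 2 := by linarith [norm_sub_le f h]
  have hgh : ‖g m - h‖ ≤ 2 := by linarith [norm_sub_le (g m) h, hDunit _ hgD]
  have hr0 := norm_nonneg (f - h)
  have hgh2 : ‖g m - h‖ ^ 2 ≤ 4 := by nlinarith [norm_nonneg (g m - h)]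
  have hstep := hmin (‖f - h‖ ^ 2 / 4) ⟨by positivity, by nlinarith⟩
  have hexp (t : ℝ) : ‖f - ((1 - t) • h + t • g m)‖ ^ 2 =
      ‖f - h‖ ^ 2 - 2 * t * ⟪f - h, g m - h⟫ + t ^ 2 * ‖g m - h‖ ^ 2 := by
    rw [show f - ((1 - t) • h + t • g m) = (f - h) - t • (g m - h) by module,
      norm_sub_sq_real, real_inner_smul_right, norm_smul, mul_pow, Real.norm_eq_abs, sq_abs]
    ring
  rw [hexp] at hstep
  nlinarith [mul_le_mul_of_nonneg_left hdecr (sq_nonneg ‖f - h‖),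
    mul_le_mul_of_nonneg_left hgh2 (sq_nonneg (‖f - h‖ ^ 2))]
end

section
/- For each natural number m ≥ 2, set n = 2m, let H = ℝⁿ with the Euclidean norm, let (e_i)_{i=1}^n be the canonical basis, and let f = (1/(2m)) ∑_{i=1}^{2m} e_i. Then for every vector s ∈ ℝⁿ having at most m nonzero coordinates (equivalently, every linear combination of at most m elements of the dictionary D = {±e_1, …, ±e_n}), one has ‖f − s‖₂ ≥ 1/(2√m). -/
/-- The lower bound showing the rate `m^{-1/2}` cannot be improved: in
`H = ℝ^{2m}` with the Euclidean norm, for `f = (1/(2m)) ∑ᵢ eᵢ`, every vector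
`s` with at most `m` nonzero coordinates (i.e. every combination of at most
`m` dictionary elements from `{±e₁, …, ±e_{2m}}`) satisfies
`‖f - s‖ ≥ 1/(2√m)`. -/
theorem stmt_12 (m : ℕ) (hm : 2 ≤ m)
    (f : EuclideanSpace ℝ (Fin (2 * m))) (hf : ∀ i, f i = 1 / (2 * (m : ℝ)))
    (s : EuclideanSpace ℝ (Fin (2 * m)))
    (hs : (Finset.univ.filter (fun i => s i ≠ 0)).card ≤ m) :
    1 / (2 * Real.sqrt m) ≤ ‖f - s‖ := by
  have hm0 : (0 : ℝ) < m := by exact_mod_cast (by omega : 0 < m)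
  have hcard : m ≤ (Finset.univ.filter (fun i => ¬ s i ≠ 0)).card := by
    have h := Finset.card_filter_add_card_filter_not (s := Finset.univ) (fun i => s i ≠ 0)
    rw [Finset.card_univ, Fintype.card_fin] at h
    omega
  refine (pow_le_pow_iff_left₀ (by positivity) (norm_nonneg _) two_ne_zero).1 ?_
  rw [EuclideanSpace.real_norm_sq_eq]
  calc (1 / (2 * Real.sqrt m)) ^ 2 = m * (1 / (2 * (m : ℝ))) ^ 2 := by
        rw [div_pow, mul_pow, Real.sq_sqrt hm0.le]
        field_simp
    _ ≤ (Finset.univ.filter (fun i => ¬ s i ≠ 0)).card * (1 / (2 * (m : ℝ))) ^ 2 := by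
        gcongr
    _ = ∑ i with ¬ s i ≠ 0, (f - s) i ^ 2 := by
        rw [← nsmul_eq_mul, ← Finset.sum_const]
        refine Finset.sum_congr rfl fun i hi => ?_
        have hsi : s i = 0 := by simpa using hi
        rw [PiLp.sub_apply, hf, hsi, sub_zero]
    _ ≤ ∑ i, (f - s) i ^ 2 :=
        Finset.sum_le_sum_of_subset_of_nonneg (Finset.filter_subset _ _)
          fun _ _ _ => sq_nonneg _
end
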